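/- For any integer τ ≥ 0 there is a constant C (depending on τ) such that for all n ≥ 1 and all λ ∈ (−π,π): |(2πn a_τ)^{−1/2} Σ_{t=1}^n h_t^τ e^{itλ}| ≤ C n^{1/2} / (1 + n|λ|)^τ, where h_t = 1 − e^{2πit/n} and a_τ = n^{−1} Σ_{t=1}^n |h_t|^{2τ}. -/

import Mathlib

open Real Finset


/-- iterated forward differences of the taper -/
noncomputable def tapG (τ : ℕ) (w : ℂ) (j t : ℕ) : ℂ :=
  ∑ k ∈ Finset.range (τ + 1), (w ^ k - 1) ^ j * ((w ^ k) ^ t * ((-1) ^ k * (τ.choose k : ℂ)))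

lemma tapG_zero (τ : ℕ) (w : ℂ) (t : ℕ) : tapG τ w 0 t = (1 - w ^ t) ^ τ := by
  unfold tapG
  rw [show (1 - w ^ t) = (-(w ^ t)) + 1 by ring, add_pow]
  refine Finset.sum_congr rfl fun k _ => ?_
  rw [neg_pow (w ^ t)]
  simp only [pow_zero, one_pow, one_mul, mul_one, ← pow_mul, mul_comm k t]
  ring

lemma tapG_succ (τ : ℕ) (w : ℂ) (j t : ℕ) :
    tapG τ w (j + 1) t = tapG τ w j (t + 1) - tapG τ w j t := by
  unfold tapG
  rw [← Finset.sum_sub_distrib]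
  refine Finset.sum_congr rfl fun k _ => ?_
  ring

lemma tapG_bound (τ : ℕ) (w : ℂ) (b : ℝ) (hb : ∀ k : ℕ, ‖w ^ k - 1‖ ≤ b * k) (hb0 : 0 ≤ b)
    (j : ℕ) : ∀ t, ‖tapG τ w j t‖ ≤ 2 ^ j * (b * (t + j : ℕ)) ^ τ := by
  induction j with
  | zero =>
    intro t
    rw [tapG_zero, norm_pow, norm_sub_rev]
    simpa using pow_le_pow_left₀ (norm_nonneg _) (hb t) τ
  | succ j ih =>
    intro t
    rw [tapG_succ]
    refine (norm_sub_le _ _).trans ?_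
    have h1 := ih (t + 1)
    have h2 := ih t
    have h3 : (b * ((t + j : ℕ) : ℝ)) ^ τ ≤ (b * ((t + (j + 1) : ℕ) : ℝ)) ^ τ := by
      gcongr
      omega
    rw [show t + 1 + j = t + (j + 1) by ring] at h1
    have h4 : (2 : ℝ) ^ j * (b * ((t + j : ℕ) : ℝ)) ^ τ
        ≤ 2 ^ j * (b * ((t + (j + 1) : ℕ) : ℝ)) ^ τ := by gcongr
    rw [pow_succ]
    linarith

lemma tapG_top (τ : ℕ) (w : ℂ) (hw : ‖w‖ = 1) (b : ℝ) (hb : ∀ k : ℕ, ‖w ^ k - 1‖ ≤ b * k)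
    (hb0 : 0 ≤ b) (t : ℕ) : ‖tapG τ w τ t‖ ≤ 2 ^ τ * (b * (τ + 1 : ℕ)) ^ τ := by
  unfold tapG
  refine (norm_sum_le _ _).trans ?_
  have h2 : (2 : ℝ) ^ τ = ∑ k ∈ Finset.range (τ + 1), (τ.choose k : ℝ) := by
    exact_mod_cast (Nat.sum_range_choose τ).symm
  rw [h2, Finset.sum_mul]
  refine Finset.sum_le_sum fun k hk => ?_
  have hk' : k ≤ τ + 1 := (Finset.mem_range.1 hk).le
  simp only [norm_mul, norm_pow, hw, one_pow, norm_neg, norm_one, one_mul, Complex.norm_natCast]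
  rw [mul_comm]
  gcongr
  refine (hb k).trans ?_
  gcongr

lemma tapG_period (τ : ℕ) (w : ℂ) (n : ℕ) (hw : w ^ n = 1) (j t : ℕ) :
    tapG τ w j (t + n) = tapG τ w j t := by
  unfold tapG
  refine Finset.sum_congr rfl fun k _ => ?_
  rw [pow_add, ← pow_mul w k n, mul_comm k n, pow_mul w n k, hw, one_pow, mul_one]

/-- transformed differences -/
noncomputable def tapS (τ : ℕ) (w z : ℂ) (n j : ℕ) : ℂ :=
  ∑ t ∈ Finset.range n, tapG τ w j (t + 1) * z ^ t

lemma tapS_rec (τ : ℕ) (w z : ℂ) (n : ℕ) (hw : w ^ n = 1) (j : ℕ) :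
    (1 - z) * tapS τ w z n j = z * tapS τ w z n (j + 1) + tapG τ w j 1 * (1 - z ^ n) := by
  have h := Finset.sum_range_sub (fun t => tapG τ w j (t + 1) * z ^ t) n
  have hp : tapG τ w j (n + 1) = tapG τ w j 1 := by
    rw [add_comm n 1]; exact tapG_period τ w n hw j 1
  rw [hp] at h
  have h2 : z * tapS τ w z n (j + 1) - (1 - z) * tapS τ w z n j =
      ∑ t ∈ Finset.range n, (tapG τ w j (t + 1 + 1) * z ^ (t + 1) - tapG τ w j (t + 1) * z ^ t) := by
    unfold tapS
    rw [Finset.mul_sum, Finset.mul_sum, ← Finset.sum_sub_distrib]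
    refine Finset.sum_congr rfl fun t _ => ?_
    rw [tapG_succ]
    ring
  rw [h] at h2
  simp only [zero_add, pow_zero] at h2
  linear_combination (-1 : ℂ) * h2

lemma tapS_ind (τ : ℕ) (w z : ℂ) (n : ℕ) (hw : w ^ n = 1) (hz : ‖z‖ = 1) (B : ℝ)
    (hB : ∀ j ≤ τ, ‖tapG τ w j 1‖ ≤ B) (j : ℕ) (hj : j ≤ τ) :
    ‖1 - z‖ ^ j * ‖tapS τ w z n 0‖ ≤ ‖tapS τ w z n j‖ + (2 * 2 ^ j - 2) * B := by
  induction j with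
  | zero => simp
  | succ j ih =>
    have ih := ih (by omega)
    have hd : ‖1 - z‖ ≤ 2 := by
      refine (norm_sub_le _ _).trans ?_
      rw [hz]; norm_num
    have hd' : ‖1 - z ^ n‖ ≤ 2 := by
      refine (norm_sub_le _ _).trans ?_
      rw [norm_pow, hz]; norm_num
    have hb := hB j (by omega)
    have hB0 : 0 ≤ B := (norm_nonneg _).trans hb
    have h1 : ‖1 - z‖ * ‖tapS τ w z n j‖ ≤ ‖tapS τ w z n (j + 1)‖ + B * 2 := by
      rw [← norm_mul, tapS_rec τ w z n hw]
      refine (norm_add_le _ _).trans ?_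
      rw [norm_mul, norm_mul, hz, one_mul]
      gcongr
    have h2 : (0 : ℝ) ≤ (2 * 2 ^ j - 2) * B := by
      have : (1 : ℝ) ≤ 2 ^ j := one_le_pow₀ (by norm_num)
      exact mul_nonneg (by linarith) hB0
    calc ‖1 - z‖ ^ (j + 1) * ‖tapS τ w z n 0‖ = ‖1 - z‖ * (‖1 - z‖ ^ j * ‖tapS τ w z n 0‖) := by ring
      _ ≤ ‖1 - z‖ * (‖tapS τ w z n j‖ + (2 * 2 ^ j - 2) * B) := by gcongr
      _ = ‖1 - z‖ * ‖tapS τ w z n j‖ + ‖1 - z‖ * ((2 * 2 ^ j - 2) * B) := by ring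
      _ ≤ (‖tapS τ w z n (j + 1)‖ + B * 2) + 2 * ((2 * 2 ^ j - 2) * B) := by gcongr
      _ = _ := by ring

lemma tap_root_bound (n : ℕ) (k : ℕ) :
    ‖Complex.exp (2 * π * Complex.I / n) ^ k - 1‖ ≤ (2 * π / n) * k := by
  rw [← Complex.exp_nat_mul]
  have := Real.norm_exp_I_mul_ofReal_sub_one_le (x := 2 * π / n * k)
  have e : (k : ℂ) * (2 * π * Complex.I / n) = Complex.I * ((2 * π / n * k : ℝ) : ℂ) := by
    push_cast; ring
  rw [e]
  refine this.trans (le_of_eq ?_)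
  rw [Real.norm_of_nonneg]
  positivity

lemma tap_lower (lam : ℝ) (h : lam ∈ Set.Ioo (-π) π) :
    |lam| / 2 ≤ ‖1 - Complex.exp (Complex.I * lam)‖ := by
  rw [norm_sub_rev, Complex.norm_exp_I_mul_ofReal_sub_one, Real.norm_eq_abs, abs_mul]
  have hl : |lam| ≤ π := abs_le.2 ⟨h.1.le, h.2.le⟩
  have h1 := Real.mul_abs_le_abs_sin (x := lam / 2) (by rw [abs_div]; simp; linarith)
  rw [abs_div, abs_two] at h1
  have h2 : (1 / 2 : ℝ) ≤ 2 / π := by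
    rw [div_le_div_iff₀ (by norm_num) Real.pi_pos]
    linarith [Real.pi_le_four]
  have h3 : (1 / 2 : ℝ) * (|lam| / 2) ≤ 2 / π * (|lam| / 2) := by gcongr
  rw [abs_two]
  linarith

lemma tap_norm_lower (τ n : ℕ) (w : ℂ) (hw : IsPrimitiveRoot w n) (hn : 2 ≤ n) (hw1 : ‖w‖ = 1) :
    (n : ℝ) ≤ ∑ t ∈ Finset.Icc 1 n, ‖1 - w ^ t‖ ^ (2 * τ) := by
  have hn0 : (0 : ℝ) < n := by exact_mod_cast (by omega : 0 < n)
  have hs0 : ∑ t ∈ Finset.Icc 1 n, w ^ t = 0 := by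
    rw [← Finset.Ico_add_one_right_eq_Icc, Finset.sum_Ico_eq_sum_range]
    simp only [add_tsub_cancel_right, pow_add, pow_one]
    rw [← Finset.mul_sum, hw.geom_sum_eq_zero (by omega), mul_zero]
  have hsq : ∑ t ∈ Finset.Icc 1 n, ‖1 - w ^ t‖ ^ 2 = 2 * n := by
    have : ∀ t : ℕ, ‖1 - w ^ t‖ ^ 2 = 2 - 2 * (w ^ t).re := by
      intro t
      have h1 : ‖w ^ t‖ ^ 2 = 1 := by rw [norm_pow, hw1]; simp
      rw [Complex.sq_norm, Complex.normSq_apply] at h1 ⊢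
      simp only [Complex.sub_re, Complex.sub_im, Complex.one_re, Complex.one_im]
      linarith
    simp only [this]
    rw [Finset.sum_sub_distrib, ← Finset.mul_sum, ← Complex.re_sum, hs0]
    simp [mul_comm]
  rcases τ with _ | m
  · simp
  · have h := pow_sum_div_card_le_sum_pow (s := Finset.Icc 1 n) (f := fun t => ‖1 - w ^ t‖ ^ 2)
      (fun _ _ => by positivity) m
    rw [hsq] at h
    simp only [← pow_mul, Nat.card_Icc, add_tsub_cancel_right] at h
    refine le_trans ?_ h
    rw [le_div_iff₀ (by positivity), mul_pow, pow_succ (n : ℝ), mul_comm (n : ℝ)]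
    exact le_mul_of_one_le_left (by positivity) (one_le_pow₀ (by norm_num))

lemma tap_sum_bound (τ n : ℕ) (hn : 1 ≤ n) (w : ℂ) (hw : w ^ n = 1) (hw1 : ‖w‖ = 1)
    (hb : ∀ k : ℕ, ‖w ^ k - 1‖ ≤ (2 * π / n) * k) (z : ℂ) (hz : ‖z‖ = 1) (x : ℝ) (hx : 0 ≤ x)
    (hxz : x / 2 ≤ ‖1 - z‖) :
    (1 + n * x) ^ τ * ‖tapS τ w z n 0‖ ≤
      (2 ^ τ * (2 ^ τ + 2 ^ τ * (1 + 2 * 2 ^ τ) * (2 ^ τ * (2 * π * (τ + 1 : ℕ)) ^ τ))) * n := by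
  have hn1 : (1 : ℝ) ≤ n := by exact_mod_cast hn
  have hn0 : (0 : ℝ) < n := by linarith
  have hb0 : 0 ≤ 2 * π / n := by positivity
  set B : ℝ := 2 ^ τ * (2 * π / n * (τ + 1 : ℕ)) ^ τ with hBd
  have hBn : (n : ℝ) ^ τ * B = 2 ^ τ * (2 * π * (τ + 1 : ℕ)) ^ τ := by
    rw [hBd, mul_left_comm, ← mul_pow]
    congr 2
    field_simp
  have hB0 : 0 ≤ B := by positivity
  have hBj : ∀ j ≤ τ, ‖tapG τ w j 1‖ ≤ B := by
    intro j hj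
    refine (tapG_bound τ w _ hb hb0 j 1).trans ?_
    have hle : 1 + j ≤ τ + 1 := by omega
    have hle' : ((1 + j : ℕ) : ℝ) ≤ ((τ + 1 : ℕ) : ℝ) := by exact_mod_cast hle
    rw [hBd]
    refine mul_le_mul (pow_le_pow_right₀ (by norm_num) hj) ?_ (by positivity) (by positivity)
    exact pow_le_pow_left₀ (by positivity) (mul_le_mul_of_nonneg_left hle' hb0) τ
  have h1 := tapS_ind τ w z n hw hz B hBj τ le_rfl
  have h2 : ‖tapS τ w z n τ‖ ≤ n * B := by
    unfold tapS
    refine (norm_sum_le _ _).trans ?_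
    refine (Finset.sum_le_card_nsmul _ _ B fun t _ => ?_).trans (by simp)
    rw [norm_mul, norm_pow, hz, one_pow, mul_one]
    exact tapG_top τ w hw1 _ hb hb0 _
  have h3 : ‖tapS τ w z n 0‖ ≤ n * 2 ^ τ := by
    unfold tapS
    refine (norm_sum_le _ _).trans ?_
    refine (Finset.sum_le_card_nsmul _ _ ((2 : ℝ) ^ τ) fun t _ => ?_).trans (by simp)
    rw [norm_mul, norm_pow, hz, one_pow, mul_one, tapG_zero, norm_pow]
    gcongr
    refine (norm_sub_le _ _).trans ?_
    rw [norm_pow, hw1]; norm_num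
  have h4 : (x / 2) ^ τ * ‖tapS τ w z n 0‖ ≤ n * ((1 + 2 * 2 ^ τ) * B) := by
    have : (x / 2) ^ τ * ‖tapS τ w z n 0‖ ≤ ‖1 - z‖ ^ τ * ‖tapS τ w z n 0‖ := by gcongr
    have h5 : (2 * 2 ^ τ - 2) * B ≤ n * (2 * 2 ^ τ * B) := by
      have : 2 * 2 ^ τ * B ≤ n * (2 * 2 ^ τ * B) := le_mul_of_one_le_left (by positivity) hn1
      linarith
    linarith
  have h6 : (n * x) ^ τ * ‖tapS τ w z n 0‖
      ≤ n * (2 ^ τ * (1 + 2 * 2 ^ τ) * (2 ^ τ * (2 * π * (τ + 1 : ℕ)) ^ τ)) := by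
    rw [← hBn]
    calc (n * x) ^ τ * ‖tapS τ w z n 0‖
        = (n ^ τ * 2 ^ τ) * ((x / 2) ^ τ * ‖tapS τ w z n 0‖) := by
          rw [← mul_assoc, ← mul_pow, ← mul_pow]; congr 2; ring
      _ ≤ (n ^ τ * 2 ^ τ) * (n * ((1 + 2 * 2 ^ τ) * B)) := by gcongr
      _ = _ := by ring
  have hnx : 0 ≤ n * x := by positivity
  have h7 : (1 + n * x) ^ τ ≤ 2 ^ τ * (1 + (n * x) ^ τ) := by
    refine (add_pow_le zero_le_one hnx τ).trans ?_
    rw [one_pow]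
    gcongr
    · norm_num
    · omega
  calc (1 + n * x) ^ τ * ‖tapS τ w z n 0‖
      ≤ 2 ^ τ * (1 + (n * x) ^ τ) * ‖tapS τ w z n 0‖ := by gcongr
    _ = 2 ^ τ * (‖tapS τ w z n 0‖ + (n * x) ^ τ * ‖tapS τ w z n 0‖) := by ring
    _ ≤ 2 ^ τ * (n * 2 ^ τ + n * (2 ^ τ * (1 + 2 * 2 ^ τ) * (2 ^ τ * (2 * π * (τ + 1 : ℕ)) ^ τ))) := by
        gcongr
    _ = _ := by ring

/-- Leakage bound for the Hurvich–Chen taper of order `τ`: there is a constant `C`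
(depending on `τ`) such that for all `n ≥ 1` and `λ ∈ (−π,π)`,
`|(2πn a_τ)^{−1/2} Σ_{t=1}^n h_t^τ e^{itλ}| ≤ C n^{1/2} / (1+n|λ|)^τ`. -/
theorem hurvich_chen_taper_leakage_bound (τ : ℕ) :
    ∃ C : ℝ, 0 < C ∧ ∀ n : ℕ, 1 ≤ n → ∀ lam : ℝ, lam ∈ Set.Ioo (-π) π →
      (Real.sqrt (2 * π * n *
          ((n : ℝ)⁻¹ * ∑ t ∈ Finset.Icc 1 n,
            ‖(1 : ℂ) - Complex.exp (2 * π * Complex.I * t / n)‖ ^ (2 * τ))))⁻¹ *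
        ‖∑ t ∈ Finset.Icc 1 n,
            (1 - Complex.exp (2 * π * Complex.I * t / n)) ^ τ *
              Complex.exp (Complex.I * t * lam)‖
      ≤ C * Real.sqrt n / (1 + n * |lam|) ^ τ := by
  refine ⟨2 ^ τ * (2 ^ τ + 2 ^ τ * (1 + 2 * 2 ^ τ) * (2 ^ τ * (2 * π * (τ + 1 : ℕ)) ^ τ)),
    by positivity, ?_⟩
  intro n hn lam hlam
  have hn0 : (0 : ℝ) < n := by exact_mod_cast hn
  have hprim := Complex.isPrimitiveRoot_exp n (by omega)
  have hrb := tap_root_bound n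
  have hexp : ∀ t : ℕ, Complex.exp (2 * π * Complex.I * t / n)
      = Complex.exp (2 * π * Complex.I / n) ^ t := by
    intro t
    rw [← Complex.exp_nat_mul]; congr 1; ring
  simp only [hexp]
  generalize Complex.exp (2 * π * Complex.I / n) = w at *
  have hw1 : ‖w‖ = 1 := hprim.norm'_eq_one (by omega)
  have hz : ‖Complex.exp (Complex.I * lam)‖ = 1 := by
    rw [mul_comm]; exact Complex.norm_exp_ofReal_mul_I lam
  have hS := tap_sum_bound τ n hn w hprim.pow_eq_one hw1 hrb _ hz |lam| (abs_nonneg _)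
    (tap_lower lam hlam)
  generalize 2 ^ τ * (2 ^ τ + 2 ^ τ * (1 + 2 * 2 ^ τ) * (2 ^ τ * (2 * π * (τ + 1 : ℕ)) ^ τ)) = C
    at *
  have hsum : ‖∑ t ∈ Finset.Icc 1 n, (1 - w ^ t) ^ τ * Complex.exp (Complex.I * t * lam)‖
      = ‖tapS τ w (Complex.exp (Complex.I * lam)) n 0‖ := by
    have : ∑ t ∈ Finset.Icc 1 n, (1 - w ^ t) ^ τ * Complex.exp (Complex.I * t * lam)
        = Complex.exp (Complex.I * lam) * tapS τ w (Complex.exp (Complex.I * lam)) n 0 := by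
      rw [← Finset.Ico_add_one_right_eq_Icc, Finset.sum_Ico_eq_sum_range]
      unfold tapS
      rw [Finset.mul_sum]
      simp only [add_tsub_cancel_right]
      refine Finset.sum_congr rfl fun t _ => ?_
      rw [tapG_zero, add_comm 1 t, mul_left_comm, ← pow_succ', ← Complex.exp_nat_mul]
      congr 2
      ring
    rw [this, norm_mul, hz, one_mul]
  rw [hsum]
  have hpos : 0 < (1 + n * |lam|) ^ τ := by positivity
  have hC : 0 ≤ C := by
    have : 0 ≤ C * n := le_trans (by positivity) hS
    exact nonneg_of_mul_nonneg_left this hn0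
  by_cases h0 : ‖tapS τ w (Complex.exp (Complex.I * lam)) n 0‖ = 0
  · rw [h0, mul_zero]; positivity
  have hlow : (n : ℝ) ≤ ∑ t ∈ Finset.Icc 1 n, ‖1 - w ^ t‖ ^ (2 * τ) := by
    rcases Nat.lt_or_ge n 2 with h | h
    · obtain rfl : n = 1 := by omega
      rcases Nat.eq_zero_or_pos τ with rfl | hτ
      · simp
      · exfalso
        apply h0
        have hw : w = 1 := by simpa using hprim.pow_eq_one
        simp [tapS, tapG_zero, hw, hτ.ne']
    · exact tap_norm_lower τ n w hprim h hw1
  have hsq : Real.sqrt n ≤ Real.sqrt (2 * π * n *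
      ((n : ℝ)⁻¹ * ∑ t ∈ Finset.Icc 1 n, ‖1 - w ^ t‖ ^ (2 * τ))) := by
    apply Real.sqrt_le_sqrt
    rw [mul_assoc (2 * π), mul_inv_cancel_left₀ hn0.ne']
    nlinarith [Real.pi_gt_three]
  have hs0 : 0 < Real.sqrt n := Real.sqrt_pos.2 hn0
  rw [le_div_iff₀ hpos]
  calc _ ≤ (Real.sqrt n)⁻¹ * ‖tapS τ w (Complex.exp (Complex.I * lam)) n 0‖
        * (1 + n * |lam|) ^ τ := by gcongr
    _ = (Real.sqrt n)⁻¹ * ((1 + n * |lam|) ^ τ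
        * ‖tapS τ w (Complex.exp (Complex.I * lam)) n 0‖) := by ring
    _ ≤ (Real.sqrt n)⁻¹ * (C * n) := by gcongr
    _ = C * Real.sqrt n := by
      rw [inv_mul_eq_div, div_eq_iff hs0.ne', mul_assoc, Real.mul_self_sqrt hn0.le]
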